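/- Let h be a Schwartz function on ℝ, a, β > 0, t, s ∈ ℝ. Then Σ_{(n,m)∈ℤ²} 2(n+1)(n+2) h((n+3t)²/(Λa)² + (m+s)²/(Λβ)²) = πΛ⁴βa³ ∫_0^∞ r h(r²) dr·2·... equals 2Λ⁴βa³ ∫_{ℝ²} x²h(x²+y²)dxdy + 2(3t-1)(3t-2)Λ²βa ∫_{ℝ²} h(x²+y²)dxdy + O(Λ^{-k}) for every k, as Λ → ∞. -/

import Mathlib

open MeasureTheory Filter Asymptotics
open scoped FourierTransform ContDiff

lemma aux_deriv (H : SchwartzMap ℝ ℂ) (m : ℕ) (c : ℝ) :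
    deriv (fun x : ℝ => (x:ℂ) ^ m * H (x ^ 2 + c)) =
      fun x : ℝ => (m:ℂ) * ((x:ℂ) ^ (m-1) * H (x ^ 2 + c)) +
        2 * ((x:ℂ) ^ (m+1) * (SchwartzMap.derivCLM ℝ ℂ H) (x ^ 2 + c)) := by
  funext x
  have h1 : HasDerivAt (fun x : ℝ => (x:ℂ) ^ m) ((m:ℂ) * (x:ℂ)^(m-1) * 1) x :=
    (Complex.ofRealCLM.hasDerivAt (x := x)).pow m
  have h2 : HasDerivAt (fun x : ℝ => x ^ 2 + c) (2 * x) x := by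
    simpa using (hasDerivAt_pow 2 x).add_const c
  have h3 : HasDerivAt H (deriv H (x^2+c)) (x^2+c) := (H.differentiableAt).hasDerivAt
  have h4 := h3.scomp x h2
  have := (h1.mul h4).deriv
  rw [SchwartzMap.derivCLM_apply]
  refine this.trans ?_
  simp
  ring

lemma aux_contDiff (H : SchwartzMap ℝ ℂ) (m : ℕ) (c : ℝ) (n : ℕ∞) :
    ContDiff ℝ n (fun x : ℝ => (x:ℂ) ^ m * H (x ^ 2 + c)) := by
  have h1 : ContDiff ℝ n (fun x : ℝ => (x:ℂ)) := Complex.ofRealCLM.contDiff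
  have h2 : ContDiff ℝ n (fun x : ℝ => H (x ^ 2 + c)) :=
    (H.smooth n).comp (by fun_prop)
  exact (h1.pow m).mul h2

lemma aux_bound0 (H : SchwartzMap ℝ ℂ) (m N : ℕ) :
    ∃ C, 0 ≤ C ∧ ∀ x c : ℝ, 0 ≤ c → ‖(x:ℂ) ^ m * H (x ^ 2 + c)‖ ≤ C * ((1+c)^N)⁻¹ * (1+x^2)⁻¹ := by
  have := H.one_add_le_sup_seminorm_apply (𝕜 := ℝ) (m := (m+1+N, 0)) (k := m+1+N) (n := 0) le_rfl le_rfl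
  set C := (2:ℝ) ^ (m+1+N, 0).1 * ((Finset.Iic (m+1+N, 0)).sup fun m => SchwartzMap.seminorm ℝ m.1 m.2) H
  refine ⟨C, ?_, ?_⟩
  · exact le_trans (by positivity) (this 0)
  intro x c hc
  have h := this (x^2+c)
  rw [norm_iteratedFDeriv_zero, Real.norm_of_nonneg (by positivity)] at h
  have hx : |x| ^ m ≤ (1 + (x^2+c)) ^ m := by
    apply pow_le_pow_left₀ (abs_nonneg _)
    nlinarith [sq_nonneg (|x| - 1), sq_abs x]
  rw [mul_assoc, ← mul_inv, ← div_eq_mul_inv, le_div_iff₀ (by positivity)]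
  rw [norm_mul, norm_pow, Complex.norm_real, Real.norm_eq_abs]
  refine le_trans ?_ h
  rw [pow_add, pow_add, pow_one]
  calc |x| ^ m * ‖H (x^2+c)‖ * ((1+c)^N * (1+x^2)) = |x|^m * (1+x^2) * (1+c)^N * ‖H (x^2+c)‖ := by ring
    _ ≤ _ := by
      gcongr
      · linarith
      · nlinarith [sq_nonneg x]

lemma aux_bound (k : ℕ) : ∀ (H : SchwartzMap ℝ ℂ) (m N : ℕ),
    ∃ C, 0 ≤ C ∧ ∀ x c : ℝ, 0 ≤ c →
      ‖iteratedDeriv k (fun x : ℝ => (x:ℂ) ^ m * H (x ^ 2 + c)) x‖ ≤ C * ((1+c)^N)⁻¹ * (1+x^2)⁻¹ := by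
  induction k with
  | zero => intro H m N; simpa using aux_bound0 H m N
  | succ k ih =>
    intro H m N
    obtain ⟨C1, h1, h1'⟩ := ih H (m-1) N
    obtain ⟨C2, h2, h2'⟩ := ih (SchwartzMap.derivCLM ℝ ℂ H) (m+1) N
    refine ⟨m * C1 + 2 * C2, by positivity, ?_⟩
    intro x c hc
    rw [iteratedDeriv_succ', aux_deriv]
    have d1 := (aux_contDiff H (m-1) c k).contDiffAt (x := x)
    have d2 := (aux_contDiff (SchwartzMap.derivCLM ℝ ℂ H) (m+1) c k).contDiffAt (x := x)
    rw [iteratedDeriv_fun_add (contDiffAt_const.mul d1) (contDiffAt_const.mul d2),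
      iteratedDeriv_const_mul _ d1, iteratedDeriv_const_mul _ d2]
    refine (norm_add_le _ _).trans ?_
    rw [norm_mul, norm_mul]
    have e1 := h1' x c hc
    have e2 := h2' x c hc
    have : ‖(m:ℂ)‖ = m := by simp
    have : ‖(2:ℂ)‖ = 2 := by simp
    simp only [*]
    calc _ ≤ (m:ℝ) * (C1 * ((1+c)^N)⁻¹ * (1+x^2)⁻¹) + 2 * (C2 * ((1+c)^N)⁻¹ * (1+x^2)⁻¹) := by gcongr
      _ = _ := by ring

lemma aux_summable (α A : ℝ) (hA : 0 < A) : Summable fun n : ℤ => (1 + (((n:ℝ) + α)/A)^2)⁻¹ := by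
  have h := ((Real.summable_one_div_int_add_rpow α 2).2 one_lt_two).mul_left (A^2)
  refine Summable.of_norm_bounded_eventually h ?_
  have : {n : ℤ | (n:ℝ) + α = 0}.Finite := by
    refine (Set.finite_singleton (⌊-α⌋)).subset ?_
    intro n hn
    have : (n:ℝ) = -α := by simp at hn; linarith
    simp [← this]
  filter_upwards [this.compl_mem_cofinite] with n hn
  have hn : (n:ℝ) + α ≠ 0 := hn
  have hp : 0 < ((n:ℝ)+α)^2 := by positivity
  rw [Real.norm_of_nonneg (by positivity), Real.rpow_two, sq_abs, mul_one_div, ← inv_div _ (A^2), div_pow]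
  gcongr
  linarith

lemma aux_sum_le (α A : ℝ) (hA : 1 ≤ A) :
    ∑' n : ℤ, (1 + (((n:ℝ) + α)/A)^2)⁻¹ ≤ A^2 * ∑' n : ℤ, (1 + (((n:ℝ) + α)/1)^2)⁻¹ := by
  rw [← tsum_mul_left]
  refine Summable.tsum_le_tsum ?_ (aux_summable α A (by linarith)) ((aux_summable α 1 one_pos).mul_left _)
  intro n
  rw [← div_eq_mul_inv, ← inv_div _ (A^2)]
  apply inv_anti₀ (by positivity)
  rw [div_one, div_pow, add_div]
  gcongr
  rw [div_le_one (by positivity)]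
  nlinarith

noncomputable def auxK : ℝ := Real.pi * ∑' n : ℤ, |(n:ℝ)| ^ (-2:ℝ)

lemma auxK_nonneg : 0 ≤ auxK :=
  mul_nonneg Real.pi_pos.le (tsum_nonneg fun n => by positivity)

lemma aux_int {f : ℝ → ℂ} (hf : Continuous f) {C : ℝ} (h : ∀ x, ‖f x‖ ≤ C * (1+x^2)⁻¹) :
    Integrable f :=
  (integrable_inv_one_add_sq.const_mul C).mono' hf.aestronglyMeasurable (ae_of_all _ h)

lemma aux_poisson (φ : ℝ → ℂ) (hφ : ContDiff ℝ ∞ φ)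
    (hb : ∀ k : ℕ, ∃ C, ∀ x, ‖iteratedDeriv k φ x‖ ≤ C * (1+x^2)⁻¹)
    (k : ℕ) (hk : 2 ≤ k) (C : ℝ) (hC : ∀ x, ‖iteratedDeriv k φ x‖ ≤ C * (1+x^2)⁻¹)
    (A : ℝ) (hA : 0 < A) (α : ℝ) :
    ‖∑' n : ℤ, φ (((n:ℝ) + α)/A) - A * ∫ x, φ x‖ ≤ auxK * C * (A * (A^k)⁻¹) := by
  set ψ : ℝ → ℂ := fun u => φ (A⁻¹ * u) with hψ
  have hψc : ContDiff ℝ ∞ ψ := hφ.comp (by fun_prop)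
  have hd : ∀ j : ℕ, iteratedDeriv j ψ = fun x => (A⁻¹)^j • iteratedDeriv j φ (A⁻¹ * x) := fun j =>
    iteratedDeriv_comp_const_smul (hφ.of_le (by exact_mod_cast le_top)) A⁻¹
  have hφi : ∀ j : ℕ, Integrable (iteratedDeriv j φ) := fun j => by
    obtain ⟨C, hC⟩ := hb j
    exact aux_int (hφ.continuous_iteratedDeriv j (by exact_mod_cast le_top)) hC
  have hψi : ∀ j : ℕ, Integrable (iteratedDeriv j ψ) := fun j => by
    rw [hd]
    exact ((hφi j).comp_mul_left' (inv_ne_zero hA.ne')).smul (A⁻¹^j : ℝ)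
  have hF := Real.fourier_iteratedDeriv (f := ψ) (N := ⊤) (n := k) hψc (fun j _ => hψi j) le_top
  have hC0 : 0 ≤ C := by
    have := (norm_nonneg _).trans (hC 0); simpa using this
  have hnorm : ∫ x, ‖iteratedDeriv k ψ x‖ ≤ Real.pi * C * (A * (A^k)⁻¹) := by
    simp only [hd, norm_smul]
    rw [integral_const_mul]
    have := Measure.integral_comp_mul_left (fun x => ‖iteratedDeriv k φ x‖) A⁻¹
    rw [this, inv_inv, abs_of_pos hA, smul_eq_mul, norm_pow, norm_inv, Real.norm_of_nonneg hA.le, inv_pow]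
    have : ∫ x, ‖iteratedDeriv k φ x‖ ≤ C * Real.pi := by
      rw [← integral_univ_inv_one_add_sq, ← integral_const_mul]
      exact integral_mono (hφi k).norm (integrable_inv_one_add_sq.const_mul C) hC
    calc (A^k)⁻¹ * (A * ∫ x, ‖iteratedDeriv k φ x‖) ≤ (A^k)⁻¹ * (A * (C * Real.pi)) := by gcongr
      _ = _ := by ring
  have hbd : ∀ n : ℤ, n ≠ 0 → ‖𝓕 ψ (n:ℝ)‖ ≤ Real.pi * C * (A * (A^k)⁻¹) * |(n:ℝ)| ^ (-2:ℝ) := by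
    intro n hn
    have h1 : ‖𝓕 (iteratedDeriv k ψ) (n:ℝ)‖ ≤ ∫ x, ‖iteratedDeriv k ψ x‖ :=
      VectorFourier.norm_fourierIntegral_le_integral_norm _ _ _ _ _
    have h1 := h1.trans hnorm
    rw [hF] at h1
    have hn1 : 1 ≤ |(n:ℝ)| := by exact_mod_cast Int.one_le_abs hn
    simp only [norm_smul, norm_pow, norm_mul, Complex.norm_I, Complex.norm_real, Complex.norm_ofNat,
      Real.norm_eq_abs, abs_of_pos Real.pi_pos, mul_one] at h1
    have h2 : |(n:ℝ)|^2 ≤ (2 * Real.pi * |(n:ℝ)|)^k := by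
      calc |(n:ℝ)|^2 ≤ |(n:ℝ)|^k := pow_le_pow_right₀ hn1 hk
        _ ≤ _ := by
          apply pow_le_pow_left₀ (abs_nonneg _)
          nlinarith [Real.pi_gt_three]
    rw [Real.rpow_neg (abs_nonneg _), Real.rpow_two, ← div_eq_mul_inv, le_div_iff₀ (by positivity), mul_comm]
    exact (mul_le_mul_of_nonneg_right h2 (norm_nonneg _)).trans h1
  have hs2 := Real.summable_abs_int_rpow (b := 2) one_lt_two
  have hsum : Summable fun n : ℤ => 𝓕 ψ (n:ℝ) := by
    refine Summable.of_norm_bounded_eventually (hs2.mul_left (Real.pi * C * (A * (A^k)⁻¹))) ?_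
    filter_upwards [(Set.finite_singleton (0:ℤ)).compl_mem_cofinite] with n hn
    exact hbd n hn
  have hdec : ψ =O[cocompact ℝ] fun x : ℝ => |x| ^ (-2:ℝ) := by
    obtain ⟨C', hC'⟩ := hb 0
    have hC'0 : 0 ≤ C' := by
      have := (norm_nonneg _).trans (hC' 0); simpa using this
    refine IsBigO.of_bound (C' * A^2) ?_
    have : ∀ᶠ x : ℝ in cocompact ℝ, x ≠ 0 := by
      have := (isCompact_singleton (x := (0:ℝ))).compl_mem_cocompact
      filter_upwards [this] with x hx using hx
    filter_upwards [this] with x hx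
    have := hC' (A⁻¹ * x)
    rw [iteratedDeriv_zero] at this
    refine this.trans ?_
    rw [Real.rpow_neg (abs_nonneg _), Real.rpow_two, sq_abs, Real.norm_of_nonneg (by positivity), mul_assoc]
    have hx2 : 0 < x^2 := by positivity
    gcongr
    rw [← div_eq_mul_inv, ← inv_div _ (A^2)]
    gcongr
    rw [mul_pow, inv_pow, div_eq_inv_mul]
    linarith
  have hP := Real.tsum_eq_tsum_fourier_of_rpow_decay_of_summable hψc.continuous one_lt_two hdec hsum α
  have e1 : ∑' n : ℤ, φ (((n:ℝ) + α)/A) = ∑' n : ℤ, ψ (α + n) := by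
    congr 1; ext n; simp only [hψ]; congr 1; rw [div_eq_inv_mul, add_comm]
  have hfn : ∀ n : ℤ, ‖fourier n (α : UnitAddCircle)‖ = 1 := fun n => by
    rw [fourier_apply]; exact Circle.norm_coe _
  have hsum' : Summable fun n : ℤ => 𝓕 ψ (n:ℝ) * fourier n (α : UnitAddCircle) := by
    apply Summable.of_norm
    simpa only [norm_mul, hfn, mul_one] using hsum.norm
  rw [e1, hP, hsum'.tsum_eq_add_tsum_ite 0]
  have e2 : 𝓕 ψ ((0:ℤ):ℝ) * fourier 0 (α : UnitAddCircle) = A * ∫ x, φ x := by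
    have := Measure.integral_comp_mul_left φ A⁻¹
    rw [inv_inv, abs_of_pos hA] at this
    simp [Real.fourier_eq', hψ, this]
  rw [e2, add_sub_cancel_left]
  have hh := hs2.hasSum.mul_left (Real.pi * C * (A * (A^k)⁻¹))
  refine (tsum_of_norm_bounded hh ?_).trans (le_of_eq (by unfold auxK; ring))
  intro n
  split_ifs with hn
  · simp only [norm_zero]; positivity
  · rw [norm_mul, hfn, mul_one]; exact hbd n hn

lemma aux_2d (f : ℝ → ℝ → ℂ) (hc : Continuous (Function.uncurry f)) (C0 Ex Ey A B α γ : ℝ)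
    (hA : 0 < A) (hB : 0 < B)
    (h0 : ∀ x y, ‖f x y‖ ≤ C0 * (1+x^2)⁻¹ * (1+y^2)⁻¹)
    (hx : ∀ y, ‖∑' n : ℤ, f (((n:ℝ) + α)/A) y - A * ∫ x, f x y‖ ≤ Ex * (1+y^2)⁻¹)
    (hy : ∀ x, ‖∑' n : ℤ, f x (((n:ℝ) + γ)/B) - B * ∫ y, f x y‖ ≤ Ey * (1+x^2)⁻¹) :
    (Summable fun nm : ℤ × ℤ => f (((nm.1:ℝ) + α)/A) (((nm.2:ℝ) + γ)/B)) ∧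
    ‖∑' nm : ℤ × ℤ, f (((nm.1:ℝ) + α)/A) (((nm.2:ℝ) + γ)/B) - A * B * ∫ x, ∫ y, f x y‖
      ≤ Ey * (∑' n : ℤ, (1 + (((n:ℝ) + α)/A)^2)⁻¹) + B * (Ex * Real.pi) := by
  have hsA := aux_summable α A hA
  have hsB := aux_summable γ B hB
  have hfy : ∀ x, Continuous (f x) := fun x => hc.comp (by fun_prop : Continuous fun y => (x, y))
  have hsum : Summable fun nm : ℤ × ℤ => f (((nm.1:ℝ) + α)/A) (((nm.2:ℝ) + γ)/B) := by
    have := (hsA.mul_of_nonneg hsB (fun n => by positivity) (fun n => by positivity)).mul_left C0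
    refine Summable.of_norm_bounded this fun nm => ?_
    rw [← mul_assoc]
    exact h0 _ _
  refine ⟨hsum, ?_⟩
  have hint : Integrable (Function.uncurry f) (volume.prod volume) := by
    refine ((integrable_inv_one_add_sq.mul_prod integrable_inv_one_add_sq).const_mul C0).mono'
      hc.aestronglyMeasurable (ae_of_all _ fun z => ?_)
    rw [← mul_assoc]
    exact h0 _ _
  have hiy : ∀ x, Integrable (f x) := fun x => aux_int (hfy x) (h0 x)
  have hnb : ∀ x, ∫ y, ‖f x y‖ ≤ C0 * Real.pi * (1+x^2)⁻¹ := fun x => by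
    have : ∫ y, ‖f x y‖ ≤ ∫ y, C0 * (1+x^2)⁻¹ * (1+y^2)⁻¹ :=
      integral_mono (hiy x).norm (integrable_inv_one_add_sq.const_mul _) (h0 x)
    rw [integral_const_mul, integral_univ_inv_one_add_sq] at this
    linarith
  have hsn : Summable fun n : ℤ => ∫ y, ‖f (((n:ℝ) + α)/A) y‖ :=
    Summable.of_nonneg_of_le (fun n => integral_nonneg fun y => norm_nonneg _)
      (fun n => hnb _) (hsA.mul_left _)
  have hG : Summable fun n : ℤ => ∫ y, f (((n:ℝ) + α)/A) y :=
    Summable.of_norm_bounded hsn fun n => norm_integral_le_integral_norm _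
  have hswap := integral_tsum_of_summable_integral_norm (fun n : ℤ => hiy (((n:ℝ) + α)/A)) hsn
  have hmain : Integrable fun y => ∫ x, f x y := hint.integral_prod_right
  have hTi : Integrable fun y => ∑' n : ℤ, f (((n:ℝ) + α)/A) y := by
    have hcont : Continuous fun y => ∑' n : ℤ, f (((n:ℝ) + α)/A) y := by
      have hC0 : 0 ≤ C0 := by simpa using (norm_nonneg _).trans (h0 0 0)
      refine continuous_tsum (fun n => hfy _) (hsA.mul_left C0) fun n y => ?_
      refine (h0 _ _).trans ?_
      apply mul_le_of_le_one_right (by positivity)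
      apply inv_le_one_of_one_le₀
      nlinarith [sq_nonneg y]
    have hd : Integrable fun y => (∑' n : ℤ, f (((n:ℝ) + α)/A) y) - A * ∫ x, f x y :=
      (integrable_inv_one_add_sq.const_mul Ex).mono'
        (hcont.aestronglyMeasurable.sub (hmain.const_mul _).aestronglyMeasurable) (ae_of_all _ hx)
    refine (hd.add (hmain.const_mul (A:ℂ))).congr (ae_of_all _ fun y => ?_)
    simp
  rw [hsum.tsum_prod]
  set T : ℤ → ℂ := fun n => ∑' m : ℤ, f (((n:ℝ) + α)/A) (((m:ℝ) + γ)/B)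
  have hT : Summable T := hsum.prod
  have e1 : ‖∑' n, T n - B * ∑' n : ℤ, ∫ y, f (((n:ℝ) + α)/A) y‖ ≤
      Ey * (∑' n : ℤ, (1 + (((n:ℝ) + α)/A)^2)⁻¹) := by
    rw [← tsum_mul_left, ← hT.tsum_sub (hG.mul_left _)]
    exact tsum_of_norm_bounded (hsA.hasSum.mul_left Ey) fun n => hy _
  have e2 : ‖(∑' n : ℤ, ∫ y, f (((n:ℝ) + α)/A) y) - A * ∫ x, ∫ y, f x y‖ ≤ Ex * Real.pi := by
    rw [hswap, integral_integral_swap hint, ← integral_const_mul, ← integral_sub hTi (hmain.const_mul _),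
      ← integral_univ_inv_one_add_sq, ← integral_const_mul]
    exact norm_integral_le_of_norm_le (integrable_inv_one_add_sq.const_mul Ex) (ae_of_all _ hx)
  have : ∑' n, T n - A * B * ∫ x, ∫ y, f x y =
      (∑' n, T n - B * ∑' n : ℤ, ∫ y, f (((n:ℝ) + α)/A) y) +
      B * ((∑' n : ℤ, ∫ y, f (((n:ℝ) + α)/A) y) - A * ∫ x, ∫ y, f x y) := by ring
  rw [this]
  refine (norm_add_le _ _).trans (add_le_add e1 ?_)
  rw [norm_mul, Complex.norm_real, Real.norm_of_nonneg hB.le]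
  gcongr

lemma aux_H (H : SchwartzMap ℝ ℂ) (j k : ℕ) (hk : 2 ≤ k) (α γ : ℝ) : ∃ D, 0 ≤ D ∧ ∀ A B : ℝ, 1 ≤ A → 1 ≤ B →
    (Summable fun nm : ℤ × ℤ => ((((nm.1:ℝ) + α)/A : ℝ) : ℂ)^j *
      H ((((nm.1:ℝ) + α)/A)^2 + (((nm.2:ℝ) + γ)/B)^2)) ∧
    ‖∑' nm : ℤ × ℤ, ((((nm.1:ℝ) + α)/A : ℝ) : ℂ)^j * H ((((nm.1:ℝ) + α)/A)^2 + (((nm.2:ℝ) + γ)/B)^2)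
       - A * B * ∫ x : ℝ, ∫ y : ℝ, (x:ℂ)^j * H (x^2+y^2)‖
      ≤ D * (A^2 * (B * (B^k)⁻¹) + B * (A * (A^k)⁻¹)) := by
  obtain ⟨C1, hC1, h1⟩ := aux_bound k H j 1
  obtain ⟨C2, hC2, h2⟩ := aux_bound k H 0 (j+1)
  obtain ⟨C0, hC0, h0⟩ := aux_bound0 H j 1
  set S := ∑' n : ℤ, (1 + (((n:ℝ) + α)/1)^2)⁻¹
  have hS : 0 ≤ S := tsum_nonneg fun n => by positivity
  have hK := auxK_nonneg
  have hpi := Real.pi_pos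
  refine ⟨auxK * C2 * S + auxK * C1 * Real.pi, by positivity, ?_⟩
  intro A B hA hB
  have hA0 : 0 < A := by linarith
  have hB0 : 0 < B := by linarith
  have hc : Continuous (Function.uncurry fun x y : ℝ => (x:ℂ)^j * H (x^2+y^2)) := by
    have := H.continuous
    unfold Function.uncurry
    fun_prop
  have key := (aux_2d (fun x y => (x:ℂ)^j * H (x^2+y^2)) hc C0 (auxK * C1 * (A * (A^k)⁻¹))
    (auxK * C2 * (B * (B^k)⁻¹)) A B α γ hA0 hB0 ?_ ?_ ?_)
  · refine ⟨key.1, key.2.trans ?_⟩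
    have hSA := aux_sum_le α A hA
    calc _ ≤ auxK * C2 * (B * (B^k)⁻¹) * (A^2 * S) + B * (auxK * C1 * (A * (A^k)⁻¹) * Real.pi) := by gcongr
      _ = auxK * C2 * S * (A^2 * (B * (B^k)⁻¹)) + auxK * C1 * Real.pi * (B * (A * (A^k)⁻¹)) := by ring
      _ ≤ _ := by
        have p1 : 0 ≤ auxK * C2 * S * (B * (A * (A^k)⁻¹)) := by positivity
        have p2 : 0 ≤ auxK * C1 * Real.pi * (A^2 * (B * (B^k)⁻¹)) := by positivity
        linarith
  · intro x y
    have := h0 x (y^2) (sq_nonneg _)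
    rw [pow_one] at this
    linarith
  · intro y
    refine (aux_poisson (fun x : ℝ => (x:ℂ)^j * H (x^2+y^2)) (aux_contDiff H j _ ⊤) (fun i => ?_) k hk
      (C1 * (1+y^2)⁻¹) (fun x => ?_) A hA0 α).trans (le_of_eq (by ring))
    · obtain ⟨C, -, h⟩ := aux_bound i H j 1
      exact ⟨_, fun x => h x (y^2) (sq_nonneg _)⟩
    · simpa using h1 x (y^2) (sq_nonneg _)
  · intro x
    have := (aux_poisson (fun y : ℝ => (y:ℂ)^0 * H (y^2+x^2)) (aux_contDiff H 0 _ ⊤) (fun i => ?_) k hk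
      (C2 * ((1+x^2)^(j+1))⁻¹) (fun y => h2 y (x^2) (sq_nonneg _)) B hB0 γ)
    · simp only [pow_zero, one_mul] at this
      simp only [add_comm (x^2) (_^2)]
      rw [tsum_mul_left, integral_const_mul, mul_left_comm, ← mul_sub, norm_mul, norm_pow, Complex.norm_real,
        Real.norm_eq_abs]
      have hxj : |x|^j ≤ (1+x^2)^j := by
        apply pow_le_pow_left₀ (abs_nonneg _)
        nlinarith [sq_nonneg (|x| - 1), sq_abs x]
      have hp : 0 < 1 + x^2 := by positivity
      calc _ ≤ (1+x^2)^j * (auxK * (C2 * ((1+x^2)^(j+1))⁻¹) * (B * (B^k)⁻¹)) := by gcongr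
        _ = auxK * C2 * (B * (B^k)⁻¹) * (1+x^2)⁻¹ := by rw [pow_succ (1+x^2)]; field_simp
    · obtain ⟨C, -, h⟩ := aux_bound i H 0 (j+1)
      exact ⟨_, fun y => h y (x^2) (sq_nonneg _)⟩

theorem stmt16 (h : SchwartzMap ℝ ℝ) (t s a β : ℝ) (ha : 0 < a) (hβ : 0 < β) :
    ∃ R : ℝ → ℝ,
      (∀ Λ : ℝ, 0 < Λ →
        ∑' nm : ℤ × ℤ,
            2 * ((nm.1 : ℝ) + 1) * ((nm.1 : ℝ) + 2)
              * h (((nm.1 : ℝ) + 3 * t) ^ 2 / (Λ * a) ^ 2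
                    + ((nm.2 : ℝ) + s) ^ 2 / (Λ * β) ^ 2)
          = 2 * Λ ^ 4 * β * a ^ 3 * (∫ x : ℝ, ∫ y : ℝ, x ^ 2 * h (x ^ 2 + y ^ 2))
            + 2 * (3 * t - 1) * (3 * t - 2) * Λ ^ 2 * β * a
              * (∫ x : ℝ, ∫ y : ℝ, h (x ^ 2 + y ^ 2))
            + R Λ)
      ∧ ∀ k : ℕ, R =O[atTop] fun Λ : ℝ => Λ ^ (-(k : ℤ)) := by
  set L : ℝ → ℝ := fun Λ => ∑' nm : ℤ × ℤ,
            2 * ((nm.1 : ℝ) + 1) * ((nm.1 : ℝ) + 2)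
              * h (((nm.1 : ℝ) + 3 * t) ^ 2 / (Λ * a) ^ 2
                    + ((nm.2 : ℝ) + s) ^ 2 / (Λ * β) ^ 2) with hL
  set J2 : ℝ := ∫ x : ℝ, ∫ y : ℝ, x ^ 2 * h (x ^ 2 + y ^ 2) with hJ2
  set J0 : ℝ := ∫ x : ℝ, ∫ y : ℝ, h (x ^ 2 + y ^ 2) with hJ0
  refine ⟨fun Λ => L Λ - (2 * Λ ^ 4 * β * a ^ 3 * J2
    + 2 * (3 * t - 1) * (3 * t - 2) * Λ ^ 2 * β * a * J0), fun Λ _ => by simp only [hL]; ring, ?_⟩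
  intro k
  set H : SchwartzMap ℝ ℂ := SchwartzMap.postcompCLM Complex.ofRealCLM h with hH
  have hHa : ∀ x, H x = (h x : ℂ) := fun x => by
    rw [hH, SchwartzMap.postcompCLM_apply]; rfl
  have I2 : ∫ x : ℝ, ∫ y : ℝ, (x:ℂ)^2 * H (x^2+y^2) = (J2 : ℂ) := by
    simp only [hHa, hJ2, ← Complex.ofReal_pow, ← Complex.ofReal_mul, integral_complex_ofReal]
  have I0 : ∫ x : ℝ, ∫ y : ℝ, (x:ℂ)^0 * H (x^2+y^2) = (J0 : ℂ) := by
    simp only [hHa, hJ0, pow_zero, one_mul, integral_complex_ofReal]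
  have I1 : ∫ x : ℝ, ∫ y : ℝ, (x:ℂ)^1 * H (x^2+y^2) = 0 := by
    have := integral_neg_eq_self (fun x : ℝ => ∫ y : ℝ, (x:ℂ)^1 * H (x^2+y^2)) volume
    simp only [pow_one, neg_sq, Complex.ofReal_neg, neg_mul, integral_neg] at this ⊢
    exact self_eq_neg.mp this.symm
  obtain ⟨D0, hD0, h0⟩ := aux_H H 0 (k+5) (by omega) (3*t) s
  obtain ⟨D1, hD1, h1⟩ := aux_H H 1 (k+5) (by omega) (3*t) s
  obtain ⟨D2, hD2, h2⟩ := aux_H H 2 (k+5) (by omega) (3*t) s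
  rw [I0] at h0
  rw [I1] at h1
  rw [I2] at h2
  set M : ℝ := 2 * D2 + |2*(6*t-3)| * D1 + |2*(3*t-1)*(3*t-2)| * D0 with hM
  have hM0 : 0 ≤ M := by positivity
  refine IsBigO.of_bound (M * (a^4 * (β * (β^(k+5))⁻¹) + a^3 * β * (a^(k+5))⁻¹)) ?_
  filter_upwards [eventually_ge_atTop 1, eventually_ge_atTop a⁻¹, eventually_ge_atTop β⁻¹] with Λ hΛ1 hΛa hΛβ
  have hΛ : 0 < Λ := by linarith
  have hA : 1 ≤ Λ * a := by rw [← inv_mul_cancel₀ ha.ne']; gcongr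
  have hB : 1 ≤ Λ * β := by rw [← inv_mul_cancel₀ hβ.ne']; gcongr
  obtain ⟨s0, e0⟩ := h0 _ _ hA hB
  obtain ⟨s1, e1⟩ := h1 _ _ hA hB
  obtain ⟨s2, e2⟩ := h2 _ _ hA hB
  set A := Λ * a with hAdef
  set B := Λ * β with hBdef
  have hA0 : A ≠ 0 := by positivity
  set W := A^2 * (B * (B^(k+5))⁻¹) + B * (A * (A^(k+5))⁻¹) with hW
  have hW0 : 0 ≤ W := by positivity
  have hLc : (L Λ : ℂ) = 2 * A^2 * (∑' nm : ℤ × ℤ, ((((nm.1:ℝ) + 3*t)/A : ℝ) : ℂ)^2 * H ((((nm.1:ℝ) + 3*t)/A)^2 + (((nm.2:ℝ) + s)/B)^2))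
     + (-(2 * (6*t-3)) * A) * (∑' nm : ℤ × ℤ, ((((nm.1:ℝ) + 3*t)/A : ℝ) : ℂ)^1 * H ((((nm.1:ℝ) + 3*t)/A)^2 + (((nm.2:ℝ) + s)/B)^2))
     + (2*(3*t-1)*(3*t-2)) * (∑' nm : ℤ × ℤ, ((((nm.1:ℝ) + 3*t)/A : ℝ) : ℂ)^0 * H ((((nm.1:ℝ) + 3*t)/A)^2 + (((nm.2:ℝ) + s)/B)^2)) := by
    rw [← tsum_mul_left, ← tsum_mul_left, ← tsum_mul_left, ← (s2.mul_left _).tsum_add (s1.mul_left _),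
      ← ((s2.mul_left _).add (s1.mul_left _)).tsum_add (s0.mul_left _), hL, Complex.ofReal_tsum]
    congr 1
    ext nm
    rw [hHa, div_pow, div_pow]
    have : (A:ℂ) ≠ 0 := by exact_mod_cast hA0
    change ((2 * ((nm.1 : ℝ) + 1) * ((nm.1 : ℝ) + 2)
              * h (((nm.1 : ℝ) + 3 * t) ^ 2 / A ^ 2 + ((nm.2 : ℝ) + s) ^ 2 / B ^ 2) : ℝ) : ℂ) = _
    generalize h (((nm.1 : ℝ) + 3 * t) ^ 2 / A ^ 2 + ((nm.2 : ℝ) + s) ^ 2 / B ^ 2) = z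
    push_cast
    field_simp
    ring
  rw [Real.norm_eq_abs, ← Real.norm_eq_abs, ← Complex.norm_real]
  set S2 := (∑' nm : ℤ × ℤ, ((((nm.1:ℝ) + 3*t)/A : ℝ) : ℂ)^2 * H ((((nm.1:ℝ) + 3*t)/A)^2 + (((nm.2:ℝ) + s)/B)^2))
  set S1 := (∑' nm : ℤ × ℤ, ((((nm.1:ℝ) + 3*t)/A : ℝ) : ℂ)^1 * H ((((nm.1:ℝ) + 3*t)/A)^2 + (((nm.2:ℝ) + s)/B)^2))
  set S0 := (∑' nm : ℤ × ℤ, ((((nm.1:ℝ) + 3*t)/A : ℝ) : ℂ)^0 * H ((((nm.1:ℝ) + 3*t)/A)^2 + (((nm.2:ℝ) + s)/B)^2))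
  have hR : ((L Λ - (2 * Λ ^ 4 * β * a ^ 3 * J2
    + 2 * (3 * t - 1) * (3 * t - 2) * Λ ^ 2 * β * a * J0) : ℝ) : ℂ) =
      ((2 * A^2 : ℝ) : ℂ) * (S2 - A * B * J2) + ((-(2*(6*t-3)) * A : ℝ) : ℂ) * (S1 - A * B * 0)
       + ((2*(3*t-1)*(3*t-2) : ℝ) : ℂ) * (S0 - A * B * J0) := by
    push_cast
    rw [hLc, hAdef, hBdef]
    push_cast
    ring
  rw [hR]
  have hAA : A ≤ A^2 := by nlinarith
  have hA2 : 1 ≤ A^2 := by nlinarith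
  have b2 : ‖((2 * A^2 : ℝ) : ℂ) * (S2 - A * B * J2)‖ ≤ 2 * D2 * (A^2 * W) := by
    rw [norm_mul, Complex.norm_real, Real.norm_of_nonneg (by positivity)]
    calc _ ≤ 2 * A^2 * (D2 * W) := by gcongr
      _ = _ := by ring
  have b1 : ‖((-(2*(6*t-3)) * A : ℝ) : ℂ) * (S1 - A * B * 0)‖ ≤ |2*(6*t-3)| * D1 * (A^2 * W) := by
    rw [norm_mul, Complex.norm_real, norm_mul, norm_neg, Real.norm_eq_abs, Real.norm_of_nonneg (by positivity : 0 ≤ A)]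
    calc _ ≤ |2*(6*t-3)| * A^2 * (D1 * W) := by gcongr
      _ = _ := by ring
  have b0 : ‖((2*(3*t-1)*(3*t-2) : ℝ) : ℂ) * (S0 - A * B * J0)‖ ≤ |2*(3*t-1)*(3*t-2)| * D0 * (A^2 * W) := by
    rw [norm_mul, Complex.norm_real, Real.norm_eq_abs]
    calc _ ≤ |2*(3*t-1)*(3*t-2)| * (D0 * W) := by gcongr
      _ ≤ |2*(3*t-1)*(3*t-2)| * (D0 * (A^2 * W)) := by gcongr; nlinarith
      _ = _ := by ring
  have htot : A^2 * W ≤ (a^4 * (β * (β^(k+5))⁻¹) + a^3 * β * (a^(k+5))⁻¹) * (Λ^k)⁻¹ := by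
    have t1 : A^2 * (A^2 * (B * (B^(k+5))⁻¹)) = a^4 * (β * (β^(k+5))⁻¹) * (Λ^k)⁻¹ := by
      rw [hAdef, hBdef, mul_pow Λ β, pow_add Λ k 5]
      field_simp
    have t2 : A^2 * (B * (A * (A^(k+5))⁻¹)) = a^3 * β * (a^(k+5))⁻¹ * (Λ^k)⁻¹ * Λ⁻¹ := by
      rw [hAdef, hBdef, mul_pow Λ a (k+5), pow_add Λ k 5]
      field_simp
    have t3 : a^3 * β * (a^(k+5))⁻¹ * (Λ^k)⁻¹ * Λ⁻¹ ≤ a^3 * β * (a^(k+5))⁻¹ * (Λ^k)⁻¹ :=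
      mul_le_of_le_one_right (by positivity) (inv_le_one_of_one_le₀ hΛ1)
    rw [hW, mul_add, t1, t2, add_mul]
    linarith
  rw [zpow_neg, zpow_natCast, Real.norm_of_nonneg (by positivity : 0 ≤ (Λ^k)⁻¹)]
  refine (norm_add₃_le).trans ?_
  calc _ ≤ M * (A^2 * W) := by rw [hM]; linarith
    _ ≤ M * ((a^4 * (β * (β^(k+5))⁻¹) + a^3 * β * (a^(k+5))⁻¹) * (Λ^k)⁻¹) := by gcongr
    _ = _ := by ring
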